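/- arXiv:1303.4358 — 4 statements merged into one kernel-verified Lean document; each statement's English description precedes it below -/
import Mathlib

section
/- For every z∈ℂ one has M₁(z) = (π/4)·Σ_{p=0}^∞ (2p+2)(2p+1)·Γ(p+1/2)/((p+1)!)² · z^{2p}, the power series having infinite radius of convergence; in particular M₁ extends to an entire function. -/
open MeasureTheory

/-- `M₁(z) = ∫₀^∞ e^{-r²} (∫₀^{2π} e^{2rz cos θ} cos²θ dθ) dr`. -/
noncomputable def M1 (z : ℂ) : ℂ :=
  ∫ r in Set.Ioi (0 : ℝ),
    Complex.exp (-(r : ℂ) ^ 2) *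
      ∫ θ in (0 : ℝ)..(2 * Real.pi),
        Complex.exp (2 * (r : ℂ) * z * (Real.cos θ : ℂ)) * (Real.cos θ : ℂ) ^ 2

theorem integral_cos_pow_even_two_pi (m : ℕ) :
    ∫ θ in (0 : ℝ)..(2 * Real.pi), Real.cos θ ^ (2 * m) =
      2 * Real.pi * (Nat.factorial (2 * m) : ℝ) / (4 ^ m * (Nat.factorial m : ℝ) ^ 2) := by
  induction m with
  | zero => simp
  | succ m ih =>
    rw [show 2 * (m + 1) = 2 * m + 2 by ring, integral_cos_pow, ih]
    simp only [Real.sin_two_pi, Real.sin_zero, Nat.factorial_succ]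
    push_cast
    have : (Nat.factorial m : ℝ) ≠ 0 := by positivity
    field_simp
    ring

theorem integral_cos_pow_odd_two_pi (m : ℕ) :
    ∫ θ in (0 : ℝ)..(2 * Real.pi), Real.cos θ ^ (2 * m + 1) = 0 := by
  induction m with
  | zero => simp
  | succ m ih =>
    rw [show 2 * (m + 1) + 1 = 2 * m + 1 + 2 by ring, integral_cos_pow, ih]
    simp

theorem integral_pow_even_mul_exp_neg_sq (p : ℕ) :
    ∫ r in Set.Ioi (0 : ℝ), r ^ (2 * p) * Real.exp (-r ^ 2) =
      Real.Gamma ((p : ℝ) + 1 / 2) / 2 := by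
  have hq : (-1 : ℝ) < ((2 * p : ℕ) : ℝ) := lt_of_lt_of_le (by norm_num) (Nat.cast_nonneg _)
  have h := integral_rpow_mul_exp_neg_rpow (p := 2) (q := ((2 * p : ℕ) : ℝ)) (by norm_num) hq
  simp only [Real.rpow_natCast, Real.rpow_two] at h
  rw [h, show (((2 * p : ℕ) : ℝ) + 1) / 2 = (p : ℝ) + 1 / 2 by push_cast; ring]
  ring

theorem integrable_exp_neg_sq_mul_exp_mul (a : ℝ) :
    Integrable fun r : ℝ => Real.exp (-r ^ 2) * Real.exp (a * r) := by
  have h := (integrable_cexp_quadratic (b := 1) (by simp) (a : ℂ) 0).norm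
  refine h.congr (Filter.Eventually.of_forall fun r => ?_)
  simp only [Complex.norm_exp, ← Real.exp_add]
  norm_num [← Complex.ofReal_pow, ← Complex.ofReal_mul]

theorem hasSum_integral_exp_mul_cos_mul_cos_sq (w : ℂ) :
    HasSum (fun n : ℕ => w ^ n / (Nat.factorial n : ℂ) *
        ((∫ θ in (0 : ℝ)..(2 * Real.pi), Real.cos θ ^ (n + 2) : ℝ) : ℂ))
      (∫ θ in (0 : ℝ)..(2 * Real.pi),
        Complex.exp (w * (Real.cos θ : ℂ)) * (Real.cos θ : ℂ) ^ 2) := by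
  have key : HasSum (fun n : ℕ => ∫ θ in (0 : ℝ)..(2 * Real.pi),
      w ^ n / (Nat.factorial n : ℂ) * ((Real.cos θ ^ (n + 2) : ℝ) : ℂ))
      (∫ θ in (0 : ℝ)..(2 * Real.pi),
        Complex.exp (w * (Real.cos θ : ℂ)) * (Real.cos θ : ℂ) ^ 2) := by
    refine intervalIntegral.hasSum_integral_of_dominated_convergence
      (fun n _ => ‖w‖ ^ n / (Nat.factorial n : ℝ)) (fun n => ?_) (fun n => ?_) ?_ ?_ ?_
    · exact (by fun_prop : Continuous fun θ : ℝ =>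
        w ^ n / (Nat.factorial n : ℂ) * ((Real.cos θ ^ (n + 2) : ℝ) : ℂ)).aestronglyMeasurable
    · refine Filter.Eventually.of_forall fun θ _ => ?_
      rw [norm_mul, norm_div, norm_pow, Complex.norm_natCast, Complex.norm_real, norm_pow]
      exact mul_le_of_le_one_right (by positivity)
        (pow_le_one₀ (norm_nonneg _) (Real.abs_cos_le_one θ))
    · exact Filter.Eventually.of_forall fun θ _ => Real.summable_pow_div_factorial _
    · exact intervalIntegrable_const
    · refine Filter.Eventually.of_forall fun θ _ => ?_
      have h := (NormedSpace.expSeries_div_hasSum_exp (w * (Real.cos θ : ℂ))).mul_right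
        ((Real.cos θ : ℂ) ^ 2)
      rw [← Complex.exp_eq_exp_ℂ] at h
      refine h.congr_fun fun n => ?_
      push_cast
      ring
  simpa only [intervalIntegral.integral_const_mul, intervalIntegral.integral_ofReal] using key

theorem abs_integral_cos_pow_two_pi_le (n : ℕ) :
    |∫ θ in (0 : ℝ)..(2 * Real.pi), Real.cos θ ^ n| ≤ 2 * Real.pi := by
  have h := intervalIntegral.norm_integral_le_of_norm_le_const (a := 0) (b := 2 * Real.pi)
    (f := fun θ => Real.cos θ ^ n) (C := 1) fun θ _ => by
      rw [norm_pow]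
      exact pow_le_one₀ (norm_nonneg _) (Real.abs_cos_le_one θ)
  simpa [abs_of_pos Real.pi_pos] using h

theorem hasSum_M1 (z : ℂ) :
    HasSum (fun n : ℕ => (((∫ r in Set.Ioi (0 : ℝ), r ^ n * Real.exp (-r ^ 2)) * 2 ^ n /
        (Nat.factorial n : ℝ) *
        (∫ θ in (0 : ℝ)..(2 * Real.pi), Real.cos θ ^ (n + 2)) : ℝ) : ℂ) * z ^ n) (M1 z) := by
  have hexp (r : ℝ) : HasSum (fun n : ℕ => Real.exp (-r ^ 2) *
      ((2 * ‖z‖ * r) ^ n / (Nat.factorial n : ℝ) * (2 * Real.pi)))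
      (Real.exp (-r ^ 2) * (Real.exp (2 * ‖z‖ * r) * (2 * Real.pi))) := by
    have h := NormedSpace.expSeries_div_hasSum_exp (2 * ‖z‖ * r)
    rw [← Real.exp_eq_exp_ℝ] at h
    exact (h.mul_right _).mul_left _
  have key : HasSum (fun n : ℕ => ∫ r in Set.Ioi (0 : ℝ),
      Complex.exp (-(r : ℂ) ^ 2) * ((2 * (r : ℂ) * z) ^ n / (Nat.factorial n : ℂ) *
        ((∫ θ in (0 : ℝ)..(2 * Real.pi), Real.cos θ ^ (n + 2) : ℝ) : ℂ))) (M1 z) := by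
    refine hasSum_integral_of_dominated_convergence
      (fun n r => Real.exp (-r ^ 2) *
        ((2 * ‖z‖ * r) ^ n / (Nat.factorial n : ℝ) * (2 * Real.pi)))
      (fun n => ?_) (fun n => ?_) ?_ ?_ ?_
    · exact Continuous.aestronglyMeasurable (by fun_prop)
    · filter_upwards [ae_restrict_mem measurableSet_Ioi] with r hr
      have hr : 0 < r := hr
      rw [norm_mul, norm_mul, norm_div, norm_pow, norm_mul, norm_mul, Complex.norm_natCast,
        Complex.norm_real, Complex.norm_real, Real.norm_of_nonneg hr.le, ← Complex.ofReal_pow,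
        ← Complex.ofReal_neg, Complex.norm_exp_ofReal, Complex.norm_two, mul_right_comm]
      gcongr
      exact abs_integral_cos_pow_two_pi_le _
    · exact Filter.Eventually.of_forall fun r => (hexp r).summable
    · refine ((integrable_exp_neg_sq_mul_exp_mul (2 * ‖z‖)).mul_const
        (2 * Real.pi)).integrableOn.congr (Filter.Eventually.of_forall fun r => ?_)
      exact (mul_assoc _ _ _).trans (hexp r).tsum_eq.symm
    · exact Filter.Eventually.of_forall fun r =>
        (hasSum_integral_exp_mul_cos_mul_cos_sq _).mul_left _
  refine key.congr_fun fun n => ?_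
  rw [Complex.ofReal_mul, Complex.ofReal_div, Complex.ofReal_mul, ← integral_complex_ofReal,
    mul_div_assoc, mul_assoc, mul_assoc, ← integral_mul_const]
  refine integral_congr_ae (Filter.Eventually.of_forall fun r => ?_)
  push_cast
  ring

theorem hasSum_M1_even (z : ℂ) :
    HasSum (fun p : ℕ => ((Real.pi : ℂ) / 4) *
      ((((2 * (p : ℝ) + 2) * (2 * (p : ℝ) + 1) * Real.Gamma ((p : ℝ) + 1 / 2) /
          ((Nat.factorial (p + 1) : ℝ)) ^ 2 : ℝ) : ℂ) * z ^ (2 * p))) (M1 z) := by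
  have hinj : Function.Injective fun p : ℕ => 2 * p := mul_right_injective₀ two_ne_zero
  refine ((hinj.hasSum_iff fun n hn => ?_).2 (hasSum_M1 z)).congr_fun fun p => ?_
  · obtain ⟨m, rfl | rfl⟩ := Nat.even_or_odd' n
    · exact absurd ⟨m, rfl⟩ hn
    · rw [show 2 * m + 1 + 2 = 2 * (m + 1) + 1 by ring, integral_cos_pow_odd_two_pi]
      simp
  · simp only [Function.comp_apply]
    rw [integral_pow_even_mul_exp_neg_sq, show 2 * p + 2 = 2 * (p + 1) by ring,
      integral_cos_pow_even_two_pi, ← mul_assoc]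
    congr 1
    rw [show (Real.pi : ℂ) / 4 = ((Real.pi / 4 : ℝ) : ℂ) by push_cast; rfl, ← Complex.ofReal_mul]
    congr 1
    rw [show 2 * (p + 1) = 2 * p + 1 + 1 by ring, Nat.factorial_succ (2 * p + 1),
      Nat.factorial_succ (2 * p), pow_mul, pow_succ (4 : ℝ) p]
    push_cast
    have h₁ : (Nat.factorial (2 * p) : ℝ) ≠ 0 := by positivity
    have h₂ : (Nat.factorial (p + 1) : ℝ) ≠ 0 := by positivity
    norm_num
    field_simp
    ring

theorem differentiable_of_hasSum_pow {f : ℂ → ℂ} {a : ℕ → ℂ}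
    (h : ∀ z, HasSum (fun n => a n * z ^ n) (f z)) : Differentiable ℂ f := by
  intro z
  have hf : f = fun w => ∑' n, a n * w ^ n := funext fun w => (h w).tsum_eq.symm
  have hd : DifferentiableOn ℂ (fun w => ∑' n, a n * w ^ n) (Metric.ball 0 (‖z‖ + 1)) := by
    refine Complex.differentiableOn_tsum_of_summable_norm (h ((‖z‖ + 1 : ℝ) : ℂ)).summable.norm
      (fun n => by fun_prop) Metric.isOpen_ball fun n w hw => ?_
    rw [norm_mul, norm_mul, norm_pow, norm_pow, Complex.norm_real,
      Real.norm_of_nonneg (by positivity)]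
    gcongr
    exact (mem_ball_zero_iff.1 hw).le
  rw [hf]
  exact hd.differentiableAt (Metric.isOpen_ball.mem_nhds (by simp))

/-- `M₁(z) = (π/4) Σ_p (2p+2)(2p+1) Γ(p+1/2)/((p+1)!)² z^{2p}`, the power series having
infinite radius of convergence; in particular `M₁` is an entire function. -/
theorem stmt3 :
    (∀ z : ℂ, Summable (fun p : ℕ =>
        (((2 * (p : ℝ) + 2) * (2 * (p : ℝ) + 1) * Real.Gamma ((p : ℝ) + 1 / 2) /
            ((Nat.factorial (p + 1) : ℝ)) ^ 2 : ℝ) : ℂ) * z ^ (2 * p))) ∧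
    (∀ z : ℂ, M1 z =
        ((Real.pi : ℂ) / 4) * ∑' p : ℕ,
          (((2 * (p : ℝ) + 2) * (2 * (p : ℝ) + 1) * Real.Gamma ((p : ℝ) + 1 / 2) /
              ((Nat.factorial (p + 1) : ℝ)) ^ 2 : ℝ) : ℂ) * z ^ (2 * p)) ∧
    Differentiable ℂ M1 := by
  have hpi : (Real.pi : ℂ) / 4 ≠ 0 := by simp [Real.pi_ne_zero]
  refine ⟨fun z => (summable_mul_left_iff hpi).1 (hasSum_M1_even z).summable, fun z => ?_,
    differentiable_of_hasSum_pow hasSum_M1⟩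
  rw [← tsum_mul_left, (hasSum_M1_even z).tsum_eq]
end

section
/- For every z∈ℂ one has M₅(z) = π·Σ_{p=0}^∞ Γ(p+1/2)/(p!)² · z^{2p}, the power series having infinite radius of convergence; in particular M₅ extends to an entire function. -/
open MeasureTheory

/-- `M₅(z) = ∫₀^∞ e^{-r²} (∫₀^{2π} e^{2rz cos θ} dθ) dr`. -/
noncomputable def M5 (z : ℂ) : ℂ :=
  ∫ r in Set.Ioi (0 : ℝ),
    Complex.exp (-(r : ℂ) ^ 2) *
      ∫ θ in (0 : ℝ)..(2 * Real.pi),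
        Complex.exp (2 * (r : ℂ) * z * (Real.cos θ : ℂ))

theorem integral_cos_pow_even_zero_two_pi (p : ℕ) :
    ∫ θ in (0 : ℝ)..(2 * Real.pi), Real.cos θ ^ (2 * p) =
      2 * Real.pi * (2 * p).factorial / (4 ^ p * (p.factorial : ℝ) ^ 2) := by
  induction p with
  | zero => simp
  | succ p ih =>
    rw [show 2 * (p + 1) = 2 * p + 2 by ring, integral_cos_pow, ih, Nat.factorial_succ (2 * p + 1),
      Nat.factorial_succ (2 * p), Nat.factorial_succ p]
    push_cast
    simp only [Real.sin_two_pi, Real.sin_zero, mul_zero, sub_zero, zero_div, zero_add]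
    have : (p.factorial : ℝ) ≠ 0 := by positivity
    field_simp
    ring

theorem integral_cos_pow_odd_zero_two_pi (p : ℕ) :
    ∫ θ in (0 : ℝ)..(2 * Real.pi), Real.cos θ ^ (2 * p + 1) = 0 := by
  induction p with
  | zero => simp
  | succ p ih =>
    rw [show 2 * (p + 1) + 1 = 2 * p + 1 + 2 by ring, integral_cos_pow, ih]
    simp

theorem hasSum_integral_exp_two_mul_mul_cos (w : ℂ) :
    HasSum (fun p : ℕ => 2 * (Real.pi : ℂ) * w ^ (2 * p) / (p.factorial : ℂ) ^ 2)
      (∫ θ in (0 : ℝ)..(2 * Real.pi), Complex.exp (2 * w * (Real.cos θ : ℂ))) := by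
  have hsum : HasSum
      (fun n : ℕ => ∫ θ in (0 : ℝ)..(2 * Real.pi),
        (2 * w * (Real.cos θ : ℂ)) ^ n / (n.factorial : ℂ))
      (∫ θ in (0 : ℝ)..(2 * Real.pi), Complex.exp (2 * w * (Real.cos θ : ℂ))) := by
    refine intervalIntegral.hasSum_integral_of_dominated_convergence
      (fun n _ => ‖2 * w‖ ^ n / (n.factorial : ℝ)) (fun n => ?_) (fun n => ?_) ?_ ?_ ?_
    · exact Continuous.aestronglyMeasurable (by fun_prop)
    · refine ae_of_all _ fun θ _ => ?_
      rw [norm_div, norm_pow, norm_mul _ (Real.cos θ : ℂ), Complex.norm_natCast, Complex.norm_real]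
      gcongr
      exact mul_le_of_le_one_right (norm_nonneg _) (Real.abs_cos_le_one θ)
    · exact ae_of_all _ fun _ _ => Real.summable_pow_div_factorial _
    · exact intervalIntegrable_const
    · refine ae_of_all _ fun θ _ => ?_
      rw [Complex.exp_eq_exp_ℂ]
      exact NormedSpace.expSeries_div_hasSum_exp _
  have hterm (n : ℕ) : ∫ θ in (0 : ℝ)..(2 * Real.pi),
      (2 * w * (Real.cos θ : ℂ)) ^ n / (n.factorial : ℂ) =
        (2 * w) ^ n / (n.factorial : ℂ) *
          ((∫ θ in (0 : ℝ)..(2 * Real.pi), Real.cos θ ^ n : ℝ) : ℂ) := by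
    rw [← intervalIntegral.integral_ofReal, ← intervalIntegral.integral_const_mul]
    congr 1 with θ
    push_cast
    ring
  simp_rw [hterm] at hsum
  have hinj : Function.Injective (fun p : ℕ => 2 * p) := fun a b h => by
    simpa using h
  rw [← hinj.hasSum_iff] at hsum
  · convert hsum using 2 with p
    have h : (p.factorial : ℂ) ≠ 0 := by exact_mod_cast p.factorial_ne_zero
    have h' : ((2 * p).factorial : ℂ) ≠ 0 := by exact_mod_cast (2 * p).factorial_ne_zero
    simp only [Function.comp_apply, integral_cos_pow_even_zero_two_pi]
    push_cast
    rw [mul_pow, pow_mul 2 2 p]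
    norm_num
    field_simp
  · intro n hn
    obtain ⟨p, rfl⟩ : Odd n := by
      rw [← Nat.not_even_iff_odd]
      rintro ⟨k, rfl⟩
      exact hn ⟨k, by simp [two_mul]⟩
    rw [integral_cos_pow_odd_zero_two_pi]
    simp

theorem Gamma_nat_add_half_le (p : ℕ) :
    Real.Gamma ((p : ℝ) + 1 / 2) ≤ √Real.pi * p.factorial := by
  induction p with
  | zero => simp [-one_div, Real.Gamma_one_half_eq]
  | succ p ih =>
    have hpos : 0 < Real.Gamma ((p : ℝ) + 1 / 2) := Real.Gamma_pos_of_pos (by positivity)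
    rw [Nat.factorial_succ]
    push_cast
    rw [add_right_comm, Real.Gamma_add_one (by positivity)]
    nlinarith

theorem summable_Gamma_div_factorial_sq_mul_pow (x : ℝ) (hx : 0 ≤ x) :
    Summable (fun p : ℕ =>
      Real.Gamma ((p : ℝ) + 1 / 2) / (p.factorial : ℝ) ^ 2 * x ^ (2 * p)) := by
  refine Summable.of_nonneg_of_le (fun p => ?_) (fun p => ?_)
    ((Real.summable_pow_div_factorial (x ^ 2)).mul_left √Real.pi)
  · have : 0 < Real.Gamma ((p : ℝ) + 1 / 2) := Real.Gamma_pos_of_pos (by positivity)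
    positivity
  · have h : (p.factorial : ℝ) ≠ 0 := by positivity
    calc _ ≤ √Real.pi * p.factorial / (p.factorial : ℝ) ^ 2 * x ^ (2 * p) := by
          gcongr
          exact Gamma_nat_add_half_le p
      _ = _ := by
          rw [pow_mul]
          field_simp

theorem norm_Gamma_div_factorial_sq_mul_pow (p : ℕ) (z : ℂ) :
    ‖((Real.Gamma ((p : ℝ) + 1 / 2) / (p.factorial : ℝ) ^ 2 : ℝ) : ℂ) * z ^ (2 * p)‖ =
      Real.Gamma ((p : ℝ) + 1 / 2) / (p.factorial : ℝ) ^ 2 * ‖z‖ ^ (2 * p) := by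
  have : 0 < Real.Gamma ((p : ℝ) + 1 / 2) := Real.Gamma_pos_of_pos (by positivity)
  rw [norm_mul, norm_pow, Complex.norm_real, Real.norm_of_nonneg (by positivity)]

theorem integrableOn_exp_neg_sq_mul_pow (n : ℕ) :
    IntegrableOn (fun r : ℝ => Real.exp (-r ^ 2) * r ^ n) (Set.Ioi 0) := by
  have h := integrableOn_rpow_mul_exp_neg_mul_sq (b := 1) one_pos (s := n)
    (by linarith [(n.cast_nonneg : (0 : ℝ) ≤ n)])
  simpa [mul_comm] using h

theorem integral_exp_neg_sq_mul_pow (p : ℕ) :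
    ∫ r in Set.Ioi (0 : ℝ), Real.exp (-r ^ 2) * r ^ (2 * p) =
      Real.Gamma ((p : ℝ) + 1 / 2) / 2 := by
  have h := integral_rpow_mul_exp_neg_rpow (p := 2) (q := (2 * p : ℕ)) two_pos
    (by linarith [((2 * p).cast_nonneg : (0 : ℝ) ≤ (2 * p : ℕ))])
  simp only [Real.rpow_natCast, Real.rpow_two] at h
  simp_rw [mul_comm (Real.exp _)]
  rw [h, show (((2 * p : ℕ) : ℝ) + 1) / 2 = p + 1 / 2 by push_cast; ring]
  ring

theorem hasSum_M5 (z : ℂ) :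
    HasSum (fun p : ℕ => (Real.pi : ℂ) *
      (((Real.Gamma ((p : ℝ) + 1 / 2) / (p.factorial : ℝ) ^ 2 : ℝ) : ℂ) * z ^ (2 * p)))
      (M5 z) := by
  let c (p : ℕ) : ℂ := 2 * (Real.pi : ℂ) * z ^ (2 * p) / (p.factorial : ℂ) ^ 2
  let F (p : ℕ) (r : ℝ) : ℂ := c p * ((Real.exp (-r ^ 2) * r ^ (2 * p) : ℝ) : ℂ)
  have hF_int (p : ℕ) : IntegrableOn (F p) (Set.Ioi 0) :=
    (integrableOn_exp_neg_sq_mul_pow (2 * p)).ofReal.const_mul (c p)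
  have hF_norm (p : ℕ) : ∫ r in Set.Ioi (0 : ℝ), ‖F p r‖ =
      Real.pi * (Real.Gamma ((p : ℝ) + 1 / 2) / (p.factorial : ℝ) ^ 2 * ‖z‖ ^ (2 * p)) := by
    have hn (r : ℝ) : ‖F p r‖ = ‖c p‖ * (Real.exp (-r ^ 2) * r ^ (2 * p)) := by
      rw [norm_mul, Complex.norm_real, Real.norm_of_nonneg]
      rw [pow_mul]
      positivity
    simp_rw [hn]
    rw [integral_const_mul, integral_exp_neg_sq_mul_pow]
    simp only [c, norm_div, norm_mul, norm_pow, Complex.norm_natCast, Complex.norm_real,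
      Complex.norm_two, Real.norm_of_nonneg Real.pi_pos.le]
    ring
  have hF_sum : Summable fun p => ∫ r in Set.Ioi (0 : ℝ), ‖F p r‖ := by
    simp_rw [hF_norm]
    exact (summable_Gamma_div_factorial_sq_mul_pow ‖z‖ (norm_nonneg z)).mul_left _
  have hF_tsum (r : ℝ) : ∑' p, F p r = Complex.exp (-(r : ℂ) ^ 2) *
      ∫ θ in (0 : ℝ)..(2 * Real.pi), Complex.exp (2 * (r : ℂ) * z * (Real.cos θ : ℂ)) := by
    have h := (hasSum_integral_exp_two_mul_mul_cos ((r : ℂ) * z)).mul_left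
      (Complex.exp (-(r : ℂ) ^ 2))
    simp only [← mul_assoc] at h
    rw [← h.tsum_eq]
    refine tsum_congr fun p => ?_
    simp only [F, c]
    push_cast
    ring
  have hF_integral (p : ℕ) : ∫ r in Set.Ioi (0 : ℝ), F p r = (Real.pi : ℂ) *
      (((Real.Gamma ((p : ℝ) + 1 / 2) / (p.factorial : ℝ) ^ 2 : ℝ) : ℂ) * z ^ (2 * p)) := by
    simp only [F]
    rw [integral_const_mul, integral_complex_ofReal, integral_exp_neg_sq_mul_pow]
    simp only [c]
    push_cast
    ring
  have h := hasSum_integral_of_summable_integral_norm hF_int hF_sum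
  simp_rw [hF_tsum, hF_integral] at h
  exact h

/-- `M₅(z) = π Σ_p Γ(p+1/2)/(p!)² z^{2p}`, the power series having infinite radius of
convergence; in particular `M₅` is an entire function. -/
theorem stmt4 :
    (∀ z : ℂ, Summable (fun p : ℕ =>
        ((Real.Gamma ((p : ℝ) + 1 / 2) / ((Nat.factorial p : ℝ)) ^ 2 : ℝ) : ℂ)
          * z ^ (2 * p))) ∧
    (∀ z : ℂ, M5 z =
        (Real.pi : ℂ) * ∑' p : ℕ,
          ((Real.Gamma ((p : ℝ) + 1 / 2) / ((Nat.factorial p : ℝ)) ^ 2 : ℝ) : ℂ)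
            * z ^ (2 * p)) ∧
    Differentiable ℂ M5 := by
  have hM5 (z : ℂ) : M5 z =
      (Real.pi : ℂ) * ∑' p : ℕ,
        ((Real.Gamma ((p : ℝ) + 1 / 2) / ((Nat.factorial p : ℝ)) ^ 2 : ℝ) : ℂ)
          * z ^ (2 * p) := by
    rw [← (hasSum_M5 z).tsum_eq, tsum_mul_left]
  refine ⟨fun z => ?_, hM5, fun z => ?_⟩
  · refine Summable.of_norm ?_
    simp_rw [norm_Gamma_div_factorial_sq_mul_pow]
    exact summable_Gamma_div_factorial_sq_mul_pow ‖z‖ (norm_nonneg z)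
  · rw [funext hM5]
    refine DifferentiableAt.const_mul (DifferentiableOn.differentiableAt
      (s := Metric.ball 0 (‖z‖ + 1)) ?_ (Metric.isOpen_ball.mem_nhds (by simp))) _
    refine Complex.differentiableOn_tsum_of_summable_norm
      (summable_Gamma_div_factorial_sq_mul_pow (‖z‖ + 1) (by positivity))
      (fun p => by fun_prop) Metric.isOpen_ball fun p w hw => ?_
    rw [norm_Gamma_div_factorial_sq_mul_pow]
    have : 0 < Real.Gamma ((p : ℝ) + 1 / 2) := Real.Gamma_pos_of_pos (by positivity)
    have hw' : ‖w‖ ≤ ‖z‖ + 1 := (mem_ball_zero_iff.mp hw).le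
    gcongr
end

section
/- For every ε>0, every η₀∈ℝ² with 0<|η₀|≤ε, and every ψ∈ℝ², the principal value p.v.∫_{ℝ²} α_{ε,η₀}(η)·(⟨η,ψ⟩/|η|³)·(η−η₀) dη exists and equals (e^{−r̄₀²}/ε)·[ (M₁(r̄₀) − r̄₀²M₃(r̄₀) − M₂(r̄₀))·⟨u₀,ψ⟩·u₀ + M₂(r̄₀)·ψ ], where r̄₀ = |η₀|/ε and u₀ = η₀/|η₀|. -/
open MeasureTheory
open scoped RealInnerProductSpace

/-- `α_{ε,η₀}(η) = ε⁻² exp(-|η-η₀|²/ε²)`. -/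
noncomputable def alphaFn (ε : ℝ) (η₀ η : EuclideanSpace ℝ (Fin 2)) : ℝ :=
  ε⁻¹ ^ 2 * Real.exp (-‖η - η₀‖ ^ 2 / ε ^ 2)

/-- `M₁(z) = ∫₀^∞ e^{-r²} (∫₀^{2π} e^{2rz cos θ} cos²θ dθ) dr` (real argument). -/
noncomputable def M1R (z : ℝ) : ℝ :=
  ∫ r in Set.Ioi (0 : ℝ),
    Real.exp (-r ^ 2) *
      ∫ θ in (0 : ℝ)..(2 * Real.pi),
        Real.exp (2 * r * z * Real.cos θ) * Real.cos θ ^ 2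

/-- `M₂(z) = ∫₀^∞ e^{-r²} (∫₀^{2π} e^{2rz cos θ} sin²θ dθ) dr` (real argument). -/
noncomputable def M2R (z : ℝ) : ℝ :=
  ∫ r in Set.Ioi (0 : ℝ),
    Real.exp (-r ^ 2) *
      ∫ θ in (0 : ℝ)..(2 * Real.pi),
        Real.exp (2 * r * z * Real.cos θ) * Real.sin θ ^ 2

/-- `M₃(z) = z⁻¹ ∫₀^∞ r⁻¹ e^{-r²} (∫₀^{2π} e^{2rz cos θ} cos θ dθ) dr` (real argument). -/
noncomputable def M3R (z : ℝ) : ℝ :=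
  z⁻¹ * ∫ r in Set.Ioi (0 : ℝ),
    r⁻¹ * Real.exp (-r ^ 2) *
      ∫ θ in (0 : ℝ)..(2 * Real.pi), Real.exp (2 * r * z * Real.cos θ) * Real.cos θ

/-- Integration over the exterior of a disc in polar coordinates with respect to an orthonormal
basis of the plane. -/
theorem setIntegral_lt_norm_eq_polar {F : Type*} [NormedAddCommGroup F] [NormedSpace ℝ F]
    (b : OrthonormalBasis (Fin 2) ℝ (EuclideanSpace ℝ (Fin 2)))
    (f : EuclideanSpace ℝ (Fin 2) → F) {s : ℝ} (hs : 0 < s) :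
    ∫ η in {η : EuclideanSpace ℝ (Fin 2) | s < ‖η‖}, f η =
      ∫ p in Set.Ioi s ×ˢ Set.Ioo (-Real.pi) Real.pi,
        p.1 • f ((p.1 * Real.cos p.2) • b 0 + (p.1 * Real.sin p.2) • b 1) := by
  have hm : MeasurableSet {η : EuclideanSpace ℝ (Fin 2) | s < ‖η‖} :=
    measurableSet_lt measurable_const measurable_norm
  have hL := (Complex.isometryOfOrthonormal b).measurePreserving
  have hemb : MeasurableEmbedding (Complex.isometryOfOrthonormal b) :=
    (Complex.isometryOfOrthonormal b).toHomeomorph.measurableEmbedding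
  rw [← integral_indicator hm, ← hL.integral_comp hemb, ← Complex.integral_comp_polarCoord_symm]
  have key : ∀ p ∈ polarCoord.target,
      p.1 • ({η : EuclideanSpace ℝ (Fin 2) | s < ‖η‖}.indicator f)
        (Complex.isometryOfOrthonormal b (Complex.polarCoord.symm p)) =
      (Set.Ioi s ×ˢ Set.univ).indicator (fun p : ℝ × ℝ =>
        p.1 • f ((p.1 * Real.cos p.2) • b 0 + (p.1 * Real.sin p.2) • b 1)) p := by
    intro p hp
    have hp1 : 0 < p.1 := hp.1
    have hval : Complex.isometryOfOrthonormal b (Complex.polarCoord.symm p) =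
        (p.1 * Real.cos p.2) • b 0 + (p.1 * Real.sin p.2) • b 1 := by
      rw [Complex.isometryOfOrthonormal_apply, Complex.polarCoord_symm_apply]
      simp [-Complex.ofReal_cos, -Complex.ofReal_sin]
    have hnorm : ‖Complex.isometryOfOrthonormal b (Complex.polarCoord.symm p)‖ = p.1 := by
      rw [LinearIsometryEquiv.norm_map, Complex.norm_polarCoord_symm, abs_of_pos hp1]
    by_cases h : s < p.1
    · rw [Set.indicator_of_mem (by rwa [Set.mem_ofPred_eq, hnorm]),
        Set.indicator_of_mem (by simpa using h), hval]
    · rw [Set.indicator_of_notMem (by rwa [Set.mem_ofPred_eq, hnorm]),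
        Set.indicator_of_notMem (by simpa using h), smul_zero]
  rw [setIntegral_congr_fun polarCoord.open_target.measurableSet key,
    setIntegral_indicator (measurableSet_Ioi.prod MeasurableSet.univ)]
  have hset : polarCoord.target ∩ Set.Ioi s ×ˢ Set.univ =
      Set.Ioi s ×ˢ Set.Ioo (-Real.pi) Real.pi := by
    ext p
    simp only [polarCoord_target, Set.mem_inter_iff, Set.mem_prod, Set.mem_Ioi, Set.mem_univ,
      and_true]
    exact ⟨fun h => ⟨h.2, h.1.2⟩, fun h => ⟨⟨hs.trans h.1, h.2⟩, h.1⟩⟩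
  rw [hset]

open scoped Pointwise in
theorem setIntegral_lt_norm_eq_smul {F : Type*} [NormedAddCommGroup F] [NormedSpace ℝ F]
    (f : EuclideanSpace ℝ (Fin 2) → F) {ε : ℝ} (hε : 0 < ε) (t : ℝ) :
    ∫ η in {η : EuclideanSpace ℝ (Fin 2) | t < ‖η‖}, f η =
      ε ^ 2 • ∫ η in {η : EuclideanSpace ℝ (Fin 2) | t / ε < ‖η‖}, f (ε • η) := by
  have hset : ε • {η : EuclideanSpace ℝ (Fin 2) | t / ε < ‖η‖} = {η | t < ‖η‖} := by
    ext η
    rw [Set.mem_smul_set_iff_inv_smul_mem₀ hε.ne']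
    simp only [Set.mem_ofPred_eq, norm_smul, norm_inv, Real.norm_eq_abs, abs_of_pos hε]
    rw [div_eq_inv_mul]
    exact mul_lt_mul_iff_right₀ (inv_pos.2 hε)
  rw [Measure.setIntegral_comp_smul_of_pos _ _ _ hε, hset, finrank_euclideanSpace_fin,
    smul_inv_smul₀ (by positivity)]

theorem integrable_exp_neg_sq_mul_exp (a : ℝ) :
    Integrable fun r : ℝ => Real.exp (-r ^ 2) * Real.exp (2 * a * r) := by
  have h := ((integrable_exp_neg_mul_sq one_pos).comp_sub_right a).mul_const (Real.exp (a ^ 2))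
  refine h.congr (Filter.Eventually.of_forall fun r => ?_)
  simp only [← Real.exp_add]
  congr 1
  ring

/-- The angular average `∫₀^{2π} e^{2rz cos θ} h(θ) dθ`. -/
noncomputable def angularIntegral (z : ℝ) (h : ℝ → ℝ) (r : ℝ) : ℝ :=
  ∫ θ in (0 : ℝ)..(2 * Real.pi), Real.exp (2 * r * z * Real.cos θ) * h θ

theorem continuous_angularIntegral (z : ℝ) {h : ℝ → ℝ} (hc : Continuous h) :
    Continuous (angularIntegral z h) := by
  refine intervalIntegral.continuous_parametric_intervalIntegral_of_continuous' ?_ _ _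
  simp only [Function.uncurry_def]
  fun_prop

theorem exp_mul_cos_le (z : ℝ) {r : ℝ} (hr : 0 ≤ r) (θ : ℝ) :
    Real.exp (2 * r * z * Real.cos θ) ≤ Real.exp (2 * |z| * r) := by
  apply Real.exp_le_exp.2
  have h : z * Real.cos θ ≤ |z| := by
    refine (le_abs_self _).trans ?_
    rw [abs_mul]
    exact mul_le_of_le_one_right (abs_nonneg z) (Real.abs_cos_le_one θ)
  nlinarith

theorem abs_angularIntegral_le (z : ℝ) {h : ℝ → ℝ} (hb : ∀ θ, |h θ| ≤ 1) {r : ℝ} (hr : 0 ≤ r) :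
    |angularIntegral z h r| ≤ 2 * Real.pi * Real.exp (2 * |z| * r) := by
  have H := intervalIntegral.norm_integral_le_of_norm_le_const (a := 0) (b := 2 * Real.pi)
    (f := fun θ => Real.exp (2 * r * z * Real.cos θ) * h θ) (C := Real.exp (2 * |z| * r)) ?_
  · rw [Real.norm_eq_abs, sub_zero, abs_of_pos Real.two_pi_pos] at H
    rw [mul_comm]
    exact H
  · intro θ _
    rw [norm_mul, Real.norm_eq_abs, Real.norm_eq_abs, abs_of_pos (Real.exp_pos _)]
    exact (mul_le_of_le_one_right (Real.exp_pos _).le (hb θ)).trans (exp_mul_cos_le z hr θ)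

theorem integrableOn_exp_neg_sq_mul_angularIntegral (z : ℝ) {h : ℝ → ℝ} (hc : Continuous h)
    (hb : ∀ θ, |h θ| ≤ 1) :
    IntegrableOn (fun r => Real.exp (-r ^ 2) * angularIntegral z h r) (Set.Ioi 0) := by
  refine Integrable.mono'
    ((integrable_exp_neg_sq_mul_exp |z|).const_mul (2 * Real.pi)).integrableOn
    ?_ ((ae_restrict_mem measurableSet_Ioi).mono fun r hr => ?_)
  · have := continuous_angularIntegral z hc
    exact Continuous.aestronglyMeasurable (by fun_prop)
  · rw [norm_mul, Real.norm_eq_abs, Real.norm_eq_abs, abs_of_pos (Real.exp_pos _)]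
    calc _ ≤ Real.exp (-r ^ 2) * (2 * Real.pi * Real.exp (2 * |z| * r)) := by
          gcongr
          exact abs_angularIntegral_le z hb (le_of_lt hr)
      _ = _ := by ring

theorem abs_exp_sub_one_le_mul_exp_abs (x : ℝ) : |Real.exp x - 1| ≤ |x| * Real.exp |x| := by
  rw [abs_le]
  have h1 := Real.add_one_le_exp x
  have h2 := Real.add_one_le_exp (-x)
  have h3 := Real.exp_pos x
  have h4 : Real.exp (-x) * Real.exp x = 1 := by rw [← Real.exp_add]; simp
  have h5 : 1 ≤ Real.exp |x| := Real.one_le_exp (abs_nonneg x)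
  have h6 : Real.exp x ≤ Real.exp |x| := Real.exp_le_exp.2 (le_abs_self x)
  have h7 := abs_nonneg x
  constructor
  · nlinarith [neg_abs_le x]
  · have : Real.exp x - 1 ≤ x * Real.exp x := by nlinarith
    exact this.trans (mul_le_mul (le_abs_self x) h6 h3.le h7)

theorem abs_angularIntegral_cos_le (z : ℝ) {r : ℝ} (hr : 0 ≤ r) :
    |angularIntegral z Real.cos r| ≤ 4 * Real.pi * |z| * r * Real.exp (2 * |z| * r) := by
  have hsub : angularIntegral z Real.cos r =
      ∫ θ in (0 : ℝ)..(2 * Real.pi), (Real.exp (2 * r * z * Real.cos θ) - 1) * Real.cos θ := by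
    simp only [sub_mul, one_mul]
    rw [intervalIntegral.integral_sub (Continuous.intervalIntegrable (by fun_prop) _ _)
      (Continuous.intervalIntegrable (by fun_prop) _ _), integral_cos]
    simp [angularIntegral]
  have H := intervalIntegral.norm_integral_le_of_norm_le_const (a := 0) (b := 2 * Real.pi)
    (f := fun θ => (Real.exp (2 * r * z * Real.cos θ) - 1) * Real.cos θ)
    (C := 2 * |z| * r * Real.exp (2 * |z| * r)) ?_
  · rw [Real.norm_eq_abs, sub_zero, abs_of_pos Real.two_pi_pos, ← hsub] at H
    refine H.trans (le_of_eq ?_)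
    ring
  · intro θ _
    have hle : |2 * r * z * Real.cos θ| ≤ 2 * |z| * r := by
      rw [abs_mul, abs_mul, abs_of_nonneg (by positivity : 0 ≤ 2 * r)]
      calc _ ≤ 2 * r * |z| * 1 := by gcongr; exact Real.abs_cos_le_one θ
        _ = _ := by ring
    rw [norm_mul, Real.norm_eq_abs, Real.norm_eq_abs]
    refine (mul_le_of_le_one_right (abs_nonneg _) (Real.abs_cos_le_one θ)).trans
      ((abs_exp_sub_one_le_mul_exp_abs _).trans ?_)
    gcongr

theorem integrableOn_inv_mul_exp_neg_sq_mul_angularIntegral_cos (z : ℝ) :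
    IntegrableOn (fun r => r⁻¹ * Real.exp (-r ^ 2) * angularIntegral z Real.cos r)
      (Set.Ioi 0) := by
  refine Integrable.mono'
    ((integrable_exp_neg_sq_mul_exp |z|).const_mul (4 * Real.pi * |z|)).integrableOn
    ?_ ((ae_restrict_mem measurableSet_Ioi).mono fun r hr => ?_)
  · have := (continuous_angularIntegral z Real.continuous_cos).measurable
    exact Measurable.aestronglyMeasurable (by fun_prop)
  · have hr : 0 < r := hr
    rw [norm_mul, Real.norm_eq_abs, Real.norm_eq_abs,
      abs_of_pos (mul_pos (inv_pos.2 hr) (Real.exp_pos _))]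
    calc _ ≤ r⁻¹ * Real.exp (-r ^ 2) * (4 * Real.pi * |z| * r * Real.exp (2 * |z| * r)) := by
          gcongr
          exact abs_angularIntegral_cos_le z hr.le
      _ = _ := by field_simp

theorem angularIntegral_eq_integral_Ioo (z r : ℝ) {h : ℝ → ℝ}
    (hp : Function.Periodic h (2 * Real.pi)) :
    angularIntegral z h r =
      ∫ θ in Set.Ioo (-Real.pi) Real.pi, Real.exp (2 * r * z * Real.cos θ) * h θ := by
  have hper : Function.Periodic (fun θ => Real.exp (2 * r * z * Real.cos θ) * h θ)
      (2 * Real.pi) := fun θ => by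
    simp only [Real.cos_add_two_pi, hp θ]
  have H := hper.intervalIntegral_add_eq 0 (-Real.pi)
  rw [zero_add, show -Real.pi + 2 * Real.pi = Real.pi by ring] at H
  rw [angularIntegral, H, intervalIntegral.integral_of_le (by linarith [Real.pi_pos]),
    integral_Ioc_eq_integral_Ioo]

theorem angularIntegral_eq_zero_of_odd (z r : ℝ) {h : ℝ → ℝ}
    (hp : Function.Periodic h (2 * Real.pi)) (ho : ∀ θ, h (-θ) = -h θ) :
    angularIntegral z h r = 0 := by
  rw [angularIntegral_eq_integral_Ioo z r hp, ← integral_Ioc_eq_integral_Ioo,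
    ← intervalIntegral.integral_of_le (by linarith [Real.pi_pos])]
  have H := intervalIntegral.integral_comp_neg (a := -Real.pi) (b := Real.pi)
    fun θ => Real.exp (2 * r * z * Real.cos θ) * h θ
  simp only [Real.cos_neg, ho, mul_neg, intervalIntegral.integral_neg, neg_neg] at H
  linarith

/-- The integrand `k(r) e^{-r²} e^{2rz cos θ} h(θ)` in polar coordinates `p = (r, θ)`. -/
noncomputable def polarKernel (z : ℝ) (k h : ℝ → ℝ) (p : ℝ × ℝ) : ℝ :=
  k p.1 * Real.exp (-p.1 ^ 2) * (Real.exp (2 * p.1 * z * Real.cos p.2) * h p.2)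

theorem integrableOn_Ioi_prod_Ioo (z : ℝ) {h k : ℝ → ℝ} (hc : Continuous h)
    (hb : ∀ θ, |h θ| ≤ 1) (hk : Measurable k) {s C : ℝ} (hs : 0 < s)
    (hkC : ∀ r, s < r → |k r| ≤ C) :
    IntegrableOn (polarKernel z k h)
      (Set.Ioi s ×ˢ Set.Ioo (-Real.pi) Real.pi) := by
  have hC : 0 ≤ C := (abs_nonneg _).trans (hkC (s + 1) (by linarith))
  have hdom : IntegrableOn (fun p : ℝ × ℝ =>
      (C * (Real.exp (-p.1 ^ 2) * Real.exp (2 * |z| * p.1))) * (1 : ℝ))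
      (Set.Ioi s ×ˢ Set.Ioo (-Real.pi) Real.pi) := by
    rw [IntegrableOn, Measure.volume_eq_prod, ← Measure.prod_restrict]
    refine Integrable.mul_prod (f := fun r =>
      C * (Real.exp (-r ^ 2) * Real.exp (2 * |z| * r))) (g := fun _ => (1 : ℝ))
      ((integrable_exp_neg_sq_mul_exp |z|).const_mul C).integrableOn ?_
    exact integrable_const 1
  refine Integrable.mono' hdom ?_
    ((ae_restrict_mem (measurableSet_Ioi.prod measurableSet_Ioo)).mono fun p hp => ?_)
  · have := hc.measurable
    exact Measurable.aestronglyMeasurable (by unfold polarKernel; fun_prop)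
  · have hp1 : s < p.1 := hp.1
    simp only [polarKernel, norm_mul, Real.norm_eq_abs, Real.abs_exp]
    calc _ ≤ C * Real.exp (-p.1 ^ 2) * (Real.exp (2 * |z| * p.1) * 1) := by
          have hcos := exp_mul_cos_le z (hs.trans hp1).le p.2
          exact mul_le_mul (mul_le_mul_of_nonneg_right (hkC _ hp1) (Real.exp_pos _).le)
            (mul_le_mul hcos (hb _) (abs_nonneg _) (Real.exp_pos _).le) (by positivity)
            (by positivity)
      _ = _ := by ring

theorem setIntegral_Ioi_prod_Ioo (z : ℝ) {h k : ℝ → ℝ} (hc : Continuous h)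
    (hp : Function.Periodic h (2 * Real.pi))
    (hb : ∀ θ, |h θ| ≤ 1) (hk : Measurable k) {s C : ℝ} (hs : 0 < s)
    (hkC : ∀ r, s < r → |k r| ≤ C) :
    ∫ p in Set.Ioi s ×ˢ Set.Ioo (-Real.pi) Real.pi, polarKernel z k h p =
    ∫ r in Set.Ioi s, k r * Real.exp (-r ^ 2) * angularIntegral z h r := by
  have H := integrableOn_Ioi_prod_Ioo z hc hb hk hs hkC
  rw [Measure.volume_eq_prod] at H ⊢
  rw [setIntegral_prod _ H]
  simp only [polarKernel, integral_const_mul, angularIntegral_eq_integral_Ioo z _ hp]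

theorem tendsto_setIntegral_Ioi_nhdsGT {g : ℝ → ℝ} (hg : IntegrableOn g (Set.Ioi 0)) :
    Filter.Tendsto (fun s => ∫ r in Set.Ioi s, g r) (nhdsWithin 0 (Set.Ioi 0))
      (nhds (∫ r in Set.Ioi 0, g r)) := by
  have hcov : AECover (volume.restrict (Set.Ioi (0 : ℝ))) (nhdsWithin 0 (Set.Ioi 0))
      fun s : ℝ => Set.Ioi s :=
    aecover_Ioi_of_Ioi (Filter.tendsto_id.mono_left nhdsWithin_le_nhds)
  refine (hcov.integral_tendsto_of_countably_generated hg).congr' ?_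
  filter_upwards [self_mem_nhdsWithin] with s hs
  rw [Measure.restrict_restrict measurableSet_Ioi,
    Set.inter_eq_left.2 (Set.Ioi_subset_Ioi (le_of_lt hs))]

theorem exists_orthonormalBasis_zero_eq {u : EuclideanSpace ℝ (Fin 2)} (hu : ‖u‖ = 1) :
    ∃ b : OrthonormalBasis (Fin 2) ℝ (EuclideanSpace ℝ (Fin 2)), b 0 = u := by
  have hv : Orthonormal ℝ (({0} : Set (Fin 2)).domRestrict fun _ => u) :=
    ⟨fun _ => hu, fun i j hij => absurd (Subsingleton.elim i j) hij⟩
  obtain ⟨b, hb⟩ := hv.exists_orthonormalBasis_extension_of_card_eq (by simp)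
  exact ⟨b, hb 0 rfl⟩

/-- The integrand of the principal value, in the rescaled polar coordinates
`η = ε (r cos θ b₀ + r sin θ b₁)` whose axis `b₀` points towards `η₀ = ε z b₀`. -/
theorem polar_integrand_eq (b : OrthonormalBasis (Fin 2) ℝ (EuclideanSpace ℝ (Fin 2)))
    (ψ : EuclideanSpace ℝ (Fin 2)) {ε : ℝ} (hε : 0 < ε) (z : ℝ) {p : ℝ × ℝ} (hp : 0 < p.1)
    {η : EuclideanSpace ℝ (Fin 2)}
    (hη : η = ε • ((p.1 * Real.cos p.2) • b 0 + (p.1 * Real.sin p.2) • b 1)) :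
    ε ^ 2 • p.1 • ((alphaFn ε ((ε * z) • b 0) η * ⟪η, ψ⟫ / ‖η‖ ^ 3) • (η - (ε * z) • b 0)) =
      (Real.exp (-z ^ 2) / ε) •
        ((⟪b 0, ψ⟫ * polarKernel z 1 (fun θ => Real.cos θ ^ 2) p
          + ⟪b 1, ψ⟫ * polarKernel z 1 (fun θ => Real.sin θ * Real.cos θ) p
          - z * (⟪b 0, ψ⟫ * polarKernel z Inv.inv Real.cos p
            + ⟪b 1, ψ⟫ * polarKernel z Inv.inv Real.sin p)) • b 0
        + (⟪b 0, ψ⟫ * polarKernel z 1 (fun θ => Real.sin θ * Real.cos θ) p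
          + ⟪b 1, ψ⟫ * polarKernel z 1 (fun θ => Real.sin θ ^ 2) p) • b 1) := by
  obtain ⟨r, θ⟩ := p
  simp only at hp hη
  have hnorm : ∀ x y : ℝ, ‖x • b 0 + y • b 1‖ ^ 2 = x ^ 2 + y ^ 2 := fun x y => by
    have h01 : ⟪b 0, b 1⟫ = 0 := b.orthonormal.2 (by decide)
    rw [norm_add_sq_real, norm_smul, norm_smul, b.orthonormal.1, b.orthonormal.1,
      real_inner_smul_left, real_inner_smul_right, h01]
    simp
  have hcs := Real.sin_sq_add_cos_sq θ
  have hη' : η = (ε * r * Real.cos θ) • b 0 + (ε * r * Real.sin θ) • b 1 := by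
    rw [hη, smul_add, smul_smul, smul_smul, mul_assoc, mul_assoc]
  have hnη : ‖η‖ = ε * r := by
    have h : ‖η‖ ^ 2 = (ε * r) ^ 2 := by
      rw [hη', hnorm]
      linear_combination (ε * r) ^ 2 * hcs
    exact (sq_eq_sq₀ (norm_nonneg _) (by positivity)).1 h
  have hsub : η - (ε * z) • b 0 =
      (ε * (r * Real.cos θ - z)) • b 0 + (ε * r * Real.sin θ) • b 1 := by
    rw [hη']
    module
  have hα : alphaFn ε ((ε * z) • b 0) η =
      ε⁻¹ ^ 2 * (Real.exp (-z ^ 2) * Real.exp (-r ^ 2) * Real.exp (2 * r * z * Real.cos θ)) := by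
    rw [alphaFn, hsub, hnorm, ← Real.exp_add, ← Real.exp_add]
    congr 2
    field_simp
    linear_combination (-r ^ 2) * hcs
  have hin : ⟪η, ψ⟫ = ε * r * (Real.cos θ * ⟪b 0, ψ⟫ + Real.sin θ * ⟪b 1, ψ⟫) := by
    rw [hη', inner_add_left, real_inner_smul_left, real_inner_smul_left]
    ring
  rw [hα, hin, hnη, hsub]
  simp only [polarKernel, Pi.one_apply, smul_add, smul_smul]
  congr 2
  · field_simp
  · field_simp

theorem truncated_integral_eq (b : OrthonormalBasis (Fin 2) ℝ (EuclideanSpace ℝ (Fin 2)))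
    (ψ : EuclideanSpace ℝ (Fin 2)) {ε : ℝ} (hε : 0 < ε) (z : ℝ) {t : ℝ} (ht : 0 < t) :
    ∫ η in {η : EuclideanSpace ℝ (Fin 2) | t < ‖η‖},
      (alphaFn ε ((ε * z) • b 0) η * ⟪η, ψ⟫ / ‖η‖ ^ 3) • (η - (ε * z) • b 0) =
    (Real.exp (-z ^ 2) / ε) •
      ((⟪b 0, ψ⟫ * (∫ r in Set.Ioi (t / ε),
            Real.exp (-r ^ 2) * angularIntegral z (fun θ => Real.cos θ ^ 2) r)
        - z * (⟪b 0, ψ⟫ * ∫ r in Set.Ioi (t / ε),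
            r⁻¹ * Real.exp (-r ^ 2) * angularIntegral z Real.cos r)) • b 0
      + (⟪b 1, ψ⟫ * ∫ r in Set.Ioi (t / ε),
            Real.exp (-r ^ 2) * angularIntegral z (fun θ => Real.sin θ ^ 2) r) • b 1) := by
  have hs : 0 < t / ε := div_pos ht hε
  have hone : ∀ r : ℝ, t / ε < r → |(1 : ℝ → ℝ) r| ≤ 1 := fun r _ => by simp
  have hinv : ∀ r : ℝ, t / ε < r → |Inv.inv r| ≤ (t / ε)⁻¹ := fun r hr => by
    rw [abs_of_pos (inv_pos.2 (hs.trans hr))]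
    exact inv_anti₀ hs hr.le
  have hcc : ∀ θ, |Real.cos θ ^ 2| ≤ 1 := fun θ => by
    rw [abs_of_nonneg (sq_nonneg _)]
    exact Real.cos_sq_le_one θ
  have hss : ∀ θ, |Real.sin θ ^ 2| ≤ 1 := fun θ => by
    rw [abs_of_nonneg (sq_nonneg _)]
    exact Real.sin_sq_le_one θ
  have hsc : ∀ θ, |Real.sin θ * Real.cos θ| ≤ 1 := fun θ => by
    rw [abs_mul]
    exact mul_le_one₀ (Real.abs_sin_le_one θ) (abs_nonneg _) (Real.abs_cos_le_one θ)
  have pcc : Function.Periodic (fun θ => Real.cos θ ^ 2) (2 * Real.pi) := fun θ => by simp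
  have pss : Function.Periodic (fun θ => Real.sin θ ^ 2) (2 * Real.pi) := fun θ => by simp
  have psc : Function.Periodic (fun θ => Real.sin θ * Real.cos θ) (2 * Real.pi) :=
    fun θ => by simp
  have icc := integrableOn_Ioi_prod_Ioo z (h := fun θ => Real.cos θ ^ 2)
    (Real.continuous_cos.pow 2) hcc measurable_one hs hone
  have iss := integrableOn_Ioi_prod_Ioo z (h := fun θ => Real.sin θ ^ 2)
    (Real.continuous_sin.pow 2) hss measurable_one hs hone
  have isc := integrableOn_Ioi_prod_Ioo z (h := fun θ => Real.sin θ * Real.cos θ)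
    (Real.continuous_sin.mul Real.continuous_cos) hsc measurable_one hs hone
  have ic := integrableOn_Ioi_prod_Ioo z Real.continuous_cos Real.abs_cos_le_one
    measurable_inv hs hinv
  have is := integrableOn_Ioi_prod_Ioo z Real.continuous_sin Real.abs_sin_le_one
    measurable_inv hs hinv
  have vcc := setIntegral_Ioi_prod_Ioo z (h := fun θ => Real.cos θ ^ 2)
    (Real.continuous_cos.pow 2) pcc hcc measurable_one hs hone
  have vss := setIntegral_Ioi_prod_Ioo z (h := fun θ => Real.sin θ ^ 2)
    (Real.continuous_sin.pow 2) pss hss measurable_one hs hone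
  have vsc := setIntegral_Ioi_prod_Ioo z (h := fun θ => Real.sin θ * Real.cos θ)
    (Real.continuous_sin.mul Real.continuous_cos) psc hsc measurable_one hs hone
  have vc := setIntegral_Ioi_prod_Ioo z Real.continuous_cos Real.cos_periodic
    Real.abs_cos_le_one measurable_inv hs hinv
  have vs := setIntegral_Ioi_prod_Ioo z Real.continuous_sin Real.sin_periodic
    Real.abs_sin_le_one measurable_inv hs hinv
  have zsc : ∀ r, angularIntegral z (fun θ => Real.sin θ * Real.cos θ) r = 0 := fun r =>
    angularIntegral_eq_zero_of_odd z r psc fun θ => by simp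
  have zs : ∀ r, angularIntegral z Real.sin r = 0 := fun r =>
    angularIntegral_eq_zero_of_odd z r Real.sin_periodic Real.sin_neg
  simp only [Pi.one_apply, one_mul] at vcc vss vsc
  simp only [zsc, zs, mul_zero, integral_zero] at vsc vs
  rw [setIntegral_lt_norm_eq_smul _ hε, setIntegral_lt_norm_eq_polar b _ hs, ← integral_smul]
  refine (setIntegral_congr_fun (measurableSet_Ioi.prod measurableSet_Ioo) fun p hp =>
    polar_integrand_eq b ψ hε z (hs.trans (Set.mem_Ioi.1 hp.1)) rfl).trans ?_
  have i1 := icc.const_mul ⟪b 0, ψ⟫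
  have i2 := isc.const_mul ⟪b 1, ψ⟫
  have i3 := ic.const_mul ⟪b 0, ψ⟫
  have i4 := is.const_mul ⟪b 1, ψ⟫
  have i5 := isc.const_mul ⟪b 0, ψ⟫
  have i6 := iss.const_mul ⟪b 1, ψ⟫
  have i12 := i1.fun_add i2
  have i34 := (i3.fun_add i4).const_mul z
  have i56 := i5.fun_add i6
  have i1234 := i12.sub' i34
  rw [integral_smul, integral_add (i1234.smul_const _) (i56.smul_const _), integral_smul_const,
    integral_smul_const, integral_sub i12 i34, integral_const_mul, integral_add i1 i2,
    integral_add i3 i4, integral_add i5 i6]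
  simp only [integral_const_mul]
  rw [vcc, vss, vsc, vc, vs]
  simp only [mul_zero, add_zero, zero_add]

/-- For `ε > 0`, `η₀ ∈ ℝ²` with `0 < |η₀| ≤ ε`, and `ψ ∈ ℝ²`, the principal value
`p.v. ∫_{ℝ²} α_{ε,η₀}(η) (⟨η,ψ⟩/|η|³) (η−η₀) dη` exists and equals
`(e^{−r̄₀²}/ε) [(M₁(r̄₀) − r̄₀²M₃(r̄₀) − M₂(r̄₀))⟨u₀,ψ⟩ u₀ + M₂(r̄₀) ψ]`,
where `r̄₀ = |η₀|/ε` and `u₀ = η₀/|η₀|`. -/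
theorem stmt7 (ε : ℝ) (hε : 0 < ε) (η₀ ψ : EuclideanSpace ℝ (Fin 2))
    (h0 : 0 < ‖η₀‖) (h1 : ‖η₀‖ ≤ ε)
    (r0 : ℝ) (hr0 : r0 = ‖η₀‖ / ε)
    (u0 : EuclideanSpace ℝ (Fin 2)) (hu0 : u0 = ‖η₀‖⁻¹ • η₀) :
    Filter.Tendsto
      (fun t : ℝ =>
        ∫ η in {η : EuclideanSpace ℝ (Fin 2) | t < ‖η‖},
          (alphaFn ε η₀ η * ⟪η, ψ⟫ / ‖η‖ ^ 3) • (η - η₀))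
      (nhdsWithin 0 (Set.Ioi 0))
      (nhds ((Real.exp (-r0 ^ 2) / ε) •
        (((M1R r0 - r0 ^ 2 * M3R r0 - M2R r0) * ⟪u0, ψ⟫) • u0 + M2R r0 • ψ))) := by
  have hr : 0 < r0 := hr0 ▸ div_pos h0 hε
  have hu : ‖u0‖ = 1 := by
    rw [hu0, norm_smul, norm_inv, norm_norm, inv_mul_cancel₀ h0.ne']
  have hη₀ : η₀ = (ε * r0) • u0 := by
    rw [hu0, hr0, smul_smul, mul_div_cancel₀ _ hε.ne', mul_inv_cancel₀ h0.ne', one_smul]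
  obtain ⟨b, rfl⟩ := exists_orthonormalBasis_zero_eq hu
  have hψ : ψ = ⟪b 0, ψ⟫ • b 0 + ⟪b 1, ψ⟫ • b 1 := by
    conv_lhs => rw [← b.sum_repr' ψ]
    exact Fin.sum_univ_two _
  have hM1 : M1R r0 = ∫ r in Set.Ioi (0 : ℝ),
      Real.exp (-r ^ 2) * angularIntegral r0 (fun θ => Real.cos θ ^ 2) r := rfl
  have hM2 : M2R r0 = ∫ r in Set.Ioi (0 : ℝ),
      Real.exp (-r ^ 2) * angularIntegral r0 (fun θ => Real.sin θ ^ 2) r := rfl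
  have hM3 : r0 * M3R r0 = ∫ r in Set.Ioi (0 : ℝ),
      r⁻¹ * Real.exp (-r ^ 2) * angularIntegral r0 Real.cos r := mul_inv_cancel_left₀ hr.ne' _
  have hlim : (Real.exp (-r0 ^ 2) / ε) •
      (((M1R r0 - r0 ^ 2 * M3R r0 - M2R r0) * ⟪b 0, ψ⟫) • b 0 + M2R r0 • ψ) =
      (Real.exp (-r0 ^ 2) / ε) •
        ((⟪b 0, ψ⟫ * M1R r0 - r0 * (⟪b 0, ψ⟫ * (r0 * M3R r0))) • b 0
          + (⟪b 1, ψ⟫ * M2R r0) • b 1) := by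
    congr 1
    conv_lhs => rw [show M2R r0 • ψ = M2R r0 • (⟪b 0, ψ⟫ • b 0 + ⟪b 1, ψ⟫ • b 1) by rw [← hψ]]
    module
  have hdiv : Filter.Tendsto (fun t : ℝ => t / ε) (nhdsWithin 0 (Set.Ioi 0))
      (nhdsWithin 0 (Set.Ioi 0)) := by
    refine tendsto_nhdsWithin_iff.2 ⟨?_, ?_⟩
    · have h : Filter.Tendsto (fun t : ℝ => t / ε) (nhds 0) (nhds (0 / ε)) :=
        Filter.tendsto_id.div_const ε
      rw [zero_div] at h
      exact h.mono_left nhdsWithin_le_nhds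
    · filter_upwards [self_mem_nhdsWithin] with t ht
      exact div_pos ht hε
  have hcc : ∀ θ, |Real.cos θ ^ 2| ≤ 1 := fun θ => by
    rw [abs_of_nonneg (sq_nonneg _)]
    exact Real.cos_sq_le_one θ
  have hss : ∀ θ, |Real.sin θ ^ 2| ≤ 1 := fun θ => by
    rw [abs_of_nonneg (sq_nonneg _)]
    exact Real.sin_sq_le_one θ
  have t1 := (tendsto_setIntegral_Ioi_nhdsGT (integrableOn_exp_neg_sq_mul_angularIntegral r0
    (h := fun θ => Real.cos θ ^ 2) (Real.continuous_cos.pow 2) hcc)).comp hdiv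
  have t2 := (tendsto_setIntegral_Ioi_nhdsGT (integrableOn_exp_neg_sq_mul_angularIntegral r0
    (h := fun θ => Real.sin θ ^ 2) (Real.continuous_sin.pow 2) hss)).comp hdiv
  have t3 := (tendsto_setIntegral_Ioi_nhdsGT
    (integrableOn_inv_mul_exp_neg_sq_mul_angularIntegral_cos r0)).comp hdiv
  rw [hlim, hM3, hM1, hM2]
  refine ((((t1.const_mul _).sub ((t3.const_mul _).const_mul r0)).smul_const _).add
    ((t2.const_mul _).smul_const _)).const_smul _ |>.congr' ?_
  filter_upwards [self_mem_nhdsWithin] with t ht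
  rw [hη₀, truncated_integral_eq b ψ hε r0 ht]
  rfl
end

section
/- For every ε>0, every η₀∈ℝ² with 0<|η₀|≤ε, every ψ∈ℝ² and every symmetric real 2×2 matrix F, one has −(1/(4π))∫_{ℝ²} (α_{ε,η₀}(η)/|η|³)·( (ηᵀFη)·ψ + ⟨ψ,η⟩·Fη ) dη = −(1/(4π))·(e^{−r̄₀²}/ε)·{ [ F²²·M₅(r̄₀) + (F¹¹−F²²)·M₁(r̄₀) ]·ψ + F·( (M₅(r̄₀)−M₁(r̄₀))·ψ + (2M₁(r̄₀)−M₅(r̄₀))·⟨ψ,u₀⟩·u₀ ) }, where r̄₀ = |η₀|/ε and u₀ = η₀/|η₀| (the integral converges absolutely). -/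
open MeasureTheory
open scoped RealInnerProductSpace

/-- Rotation by `π/2`: `(v₁,v₂)^⊥ = (−v₂,v₁)`. -/
noncomputable def perp (v : EuclideanSpace ℝ (Fin 2)) : EuclideanSpace ℝ (Fin 2) :=
  EuclideanSpace.single 0 (-(v 1)) + EuclideanSpace.single 1 (v 0)

/-- `M₅(z) = ∫₀^∞ e^{-r²} (∫₀^{2π} e^{2rz cos θ} dθ) dr` (real argument). -/
noncomputable def M5R (z : ℝ) : ℝ :=
  ∫ r in Set.Ioi (0 : ℝ),
    Real.exp (-r ^ 2) *
      ∫ θ in (0 : ℝ)..(2 * Real.pi), Real.exp (2 * r * z * Real.cos θ)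

/-- Integrability on `ℂ` in polar coordinates. -/
theorem Complex.integrable_iff_integrableOn_polarCoord {G : Type*} [NormedAddCommGroup G]
    [NormedSpace ℝ G] (f : ℂ → G) :
    Integrable f ↔
      IntegrableOn (fun p : ℝ × ℝ => p.1 • f (Complex.polarCoord.symm p)) polarCoord.target := by
  rw [← (Complex.volume_preserving_equiv_real_prod.symm).integrable_comp_emb
    Complex.measurableEquivRealProd.symm.measurableEmbedding, ← integrableOn_univ,
    ← integrableOn_congr_set_ae polarCoord_source_ae_eq_univ,
    ← polarCoord.symm_image_target_eq_source,
    integrableOn_image_iff_integrableOn_abs_det_fderiv_smul volume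
      polarCoord.open_target.measurableSet
      (fun p _ => (hasFDerivAt_polarCoord_symm p).hasFDerivWithinAt) polarCoord.symm.injOn]
  refine integrableOn_congr_fun (fun p hp => ?_) polarCoord.open_target.measurableSet
  have hp' : 0 < p.1 := hp.1
  simp only [det_fderivPolarCoordSymm, abs_of_pos hp', Function.comp_apply,
    Complex.measurableEquivRealProd_symm_polarCoord_symm_apply]

theorem norm_sq_perp (u : EuclideanSpace ℝ (Fin 2)) : ‖perp u‖ ^ 2 = ‖u‖ ^ 2 := by
  simp [EuclideanSpace.norm_sq_eq, Fin.sum_univ_two, perp, add_comm]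

theorem inner_self_perp (u : EuclideanSpace ℝ (Fin 2)) : ⟪u, perp u⟫ = 0 := by
  simp [PiLp.inner_apply, Fin.sum_univ_two, perp, mul_comm]

theorem orthonormal_self_perp {u : EuclideanSpace ℝ (Fin 2)} (hu : ‖u‖ = 1) :
    Orthonormal ℝ ![u, perp u] := by
  have hp : ‖perp u‖ = 1 := by
    have := norm_sq_perp u
    rw [hu] at this
    nlinarith [norm_nonneg (perp u)]
  refine ⟨fun i => ?_, fun i j hij => ?_⟩
  · fin_cases i <;> simp [hu, hp]
  · fin_cases i <;> fin_cases j <;>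
      simp_all [inner_self_perp, real_inner_comm u (perp u)]

/-- The isometry `ℂ ≃ ℝ²` sending `1` to the unit vector `u` and `I` to `perp u`. -/
noncomputable def frameIsometry {u : EuclideanSpace ℝ (Fin 2)} (hu : ‖u‖ = 1) :
    ℂ ≃ₗᵢ[ℝ] EuclideanSpace ℝ (Fin 2) :=
  Complex.isometryOfOrthonormal (basisOfOrthonormalOfCardEqFinrank (orthonormal_self_perp hu)
    (by simp) |>.toOrthonormalBasis (by simpa using orthonormal_self_perp hu))

theorem frameIsometry_apply {u : EuclideanSpace ℝ (Fin 2)} (hu : ‖u‖ = 1) (z : ℂ) :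
    frameIsometry hu z = z.re • u + z.im • perp u := by
  simp [frameIsometry, Complex.isometryOfOrthonormal_apply]

theorem frameIsometry_polarCoord_symm {u : EuclideanSpace ℝ (Fin 2)} (hu : ‖u‖ = 1) (p : ℝ × ℝ) :
    frameIsometry hu (Complex.polarCoord.symm p) =
      p.1 • (Real.cos p.2 • u + Real.sin p.2 • perp u) := by
  rw [frameIsometry_apply, Complex.polarCoord_symm_apply]
  simp [smul_smul, Complex.cos_ofReal_re, Complex.sin_ofReal_re]

theorem integrable_iff_integrableOn_polarCoord_frame {G : Type*} [NormedAddCommGroup G]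
    [NormedSpace ℝ G] {u : EuclideanSpace ℝ (Fin 2)} (hu : ‖u‖ = 1)
    (f : EuclideanSpace ℝ (Fin 2) → G) :
    Integrable f ↔ IntegrableOn (fun p : ℝ × ℝ =>
      p.1 • f (p.1 • (Real.cos p.2 • u + Real.sin p.2 • perp u))) polarCoord.target := by
  rw [← (frameIsometry hu).measurePreserving.integrable_comp_emb
    (frameIsometry hu).toHomeomorph.measurableEmbedding,
    Complex.integrable_iff_integrableOn_polarCoord]
  simp only [Function.comp_apply, frameIsometry_polarCoord_symm]

theorem integral_polarCoord_frame {G : Type*} [NormedAddCommGroup G]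
    [NormedSpace ℝ G] {u : EuclideanSpace ℝ (Fin 2)} (hu : ‖u‖ = 1)
    (f : EuclideanSpace ℝ (Fin 2) → G) :
    ∫ η, f η = ∫ p in polarCoord.target,
      p.1 • f (p.1 • (Real.cos p.2 • u + Real.sin p.2 • perp u)) := by
  rw [← (frameIsometry hu).measurePreserving.integral_comp
    (frameIsometry hu).toHomeomorph.measurableEmbedding,
    ← Complex.integral_comp_polarCoord_symm]
  simp only [frameIsometry_polarCoord_symm]

/-- The weight `e^{-r²} e^{2rz cos θ}` at the point with polar coordinates `p = (r, θ)`. -/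
noncomputable def polarWeight (z : ℝ) (p : ℝ × ℝ) : ℝ :=
  Real.exp (-p.1 ^ 2) * Real.exp (2 * p.1 * z * Real.cos p.2)

theorem polarWeight_le (z : ℝ) (p : ℝ × ℝ) :
    polarWeight z p ≤ Real.exp (2 * z ^ 2) * Real.exp (-(1 / 2) * p.1 ^ 2) := by
  rw [polarWeight, ← Real.exp_add, ← Real.exp_add, Real.exp_le_exp]
  have h := Real.sin_sq_add_cos_sq p.2
  nlinarith [sq_nonneg (p.1 - 2 * z * Real.cos p.2), mul_nonneg (sq_nonneg z)
    (sq_nonneg (Real.sin p.2))]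

theorem integrableOn_polarWeight_mul (z : ℝ) {g : ℝ → ℝ} (hg : Continuous g)
    (hg1 : ∀ θ, |g θ| ≤ 1) :
    IntegrableOn (fun p => polarWeight z p * g p.2) polarCoord.target := by
  have hint : IntegrableOn (fun p : ℝ × ℝ =>
      (Real.exp (2 * z ^ 2) * Real.exp (-(1 / 2) * p.1 ^ 2)) * 1) polarCoord.target := by
    rw [polarCoord_target, IntegrableOn, Measure.volume_eq_prod, ← Measure.prod_restrict]
    refine Integrable.mul_prod (f := fun r : ℝ =>
      Real.exp (2 * z ^ 2) * Real.exp (-(1 / 2) * r ^ 2)) (g := fun _ : ℝ => (1 : ℝ)) ?_ ?_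
    · exact ((integrable_exp_neg_mul_sq (by norm_num)).const_mul _).integrableOn
    · simp
  refine Integrable.mono' hint (Continuous.aestronglyMeasurable ?_) (ae_of_all _ fun p => ?_)
  · unfold polarWeight
    fun_prop
  · have h0 : 0 ≤ polarWeight z p := by unfold polarWeight; positivity
    rw [Real.norm_eq_abs, abs_mul, abs_of_nonneg h0]
    exact mul_le_mul (polarWeight_le z p) (hg1 _) (abs_nonneg _) (h0.trans (polarWeight_le z p))

theorem integral_polarWeight_mul (z : ℝ) {g : ℝ → ℝ} (hg : Continuous g)
    (hg1 : ∀ θ, |g θ| ≤ 1) :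
    ∫ p in polarCoord.target, polarWeight z p * g p.2 =
      ∫ r in Set.Ioi (0 : ℝ), Real.exp (-r ^ 2) *
        ∫ θ in (-Real.pi)..Real.pi, Real.exp (2 * r * z * Real.cos θ) * g θ := by
  have hint := integrableOn_polarWeight_mul z hg hg1
  rw [polarCoord_target, Measure.volume_eq_prod] at hint ⊢
  rw [setIntegral_prod _ hint]
  refine setIntegral_congr_fun measurableSet_Ioi fun r _ => ?_
  simp only [polarWeight]
  rw [intervalIntegral.integral_of_le (by linarith [Real.pi_pos]), integral_Ioc_eq_integral_Ioo,
    ← integral_const_mul]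
  simp only [mul_assoc]

theorem Function.Periodic.intervalIntegral_neg_pi_pi {f : ℝ → ℝ}
    (hf : Function.Periodic f (2 * Real.pi)) :
    ∫ θ in (-Real.pi)..Real.pi, f θ = ∫ θ in (0 : ℝ)..(2 * Real.pi), f θ := by
  have := hf.intervalIntegral_add_eq (-Real.pi) 0
  rwa [zero_add, show -Real.pi + 2 * Real.pi = Real.pi by ring] at this

theorem integral_polarWeight (z : ℝ) : ∫ p in polarCoord.target, polarWeight z p = M5R z := by
  have h := integral_polarWeight_mul z (g := fun _ => 1) continuous_const (by simp)
  simp only [mul_one] at h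
  rw [h, M5R]
  congr! 3 with r
  exact Function.Periodic.intervalIntegral_neg_pi_pi fun θ => by simp

theorem integral_polarWeight_mul_cos_sq (z : ℝ) :
    ∫ p in polarCoord.target, polarWeight z p * Real.cos p.2 ^ 2 = M1R z := by
  rw [integral_polarWeight_mul z (g := fun θ => Real.cos θ ^ 2) (by fun_prop)
    (fun θ => by rw [abs_of_nonneg (sq_nonneg _)]; exact Real.cos_sq_le_one θ), M1R]
  congr! 3 with r
  exact Function.Periodic.intervalIntegral_neg_pi_pi fun θ => by simp

theorem integrableOn_polarWeight (z : ℝ) : IntegrableOn (polarWeight z) polarCoord.target := by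
  simpa using integrableOn_polarWeight_mul z (g := fun _ => 1) continuous_const (by simp)

theorem integrableOn_polarWeight_mul_cos_sq (z : ℝ) :
    IntegrableOn (fun p => polarWeight z p * Real.cos p.2 ^ 2) polarCoord.target :=
  integrableOn_polarWeight_mul z (g := fun θ => Real.cos θ ^ 2) (by fun_prop)
    fun θ => by rw [abs_of_nonneg (sq_nonneg _)]; exact Real.cos_sq_le_one θ

theorem abs_cos_mul_sin_le_one (θ : ℝ) : |Real.cos θ * Real.sin θ| ≤ 1 := by
  rw [abs_mul]
  exact mul_le_one₀ (Real.abs_cos_le_one θ) (abs_nonneg _) (Real.abs_sin_le_one θ)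

theorem integrableOn_polarWeight_mul_cos_mul_sin (z : ℝ) :
    IntegrableOn (fun p => polarWeight z p * (Real.cos p.2 * Real.sin p.2)) polarCoord.target :=
  integrableOn_polarWeight_mul z (g := fun θ => Real.cos θ * Real.sin θ) (by fun_prop)
    abs_cos_mul_sin_le_one

theorem integral_polarWeight_mul_cos_mul_sin (z : ℝ) :
    ∫ p in polarCoord.target, polarWeight z p * (Real.cos p.2 * Real.sin p.2) = 0 := by
  rw [integral_polarWeight_mul z (g := fun θ => Real.cos θ * Real.sin θ) (by fun_prop)
    abs_cos_mul_sin_le_one]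
  have hodd (r : ℝ) : ∫ θ in (-Real.pi)..Real.pi,
      Real.exp (2 * r * z * Real.cos θ) * (Real.cos θ * Real.sin θ) = 0 := by
    have h := intervalIntegral.integral_comp_neg (a := -Real.pi) (b := Real.pi)
      fun θ => Real.exp (2 * r * z * Real.cos θ) * (Real.cos θ * Real.sin θ)
    simp only [Real.cos_neg, Real.sin_neg, mul_neg, intervalIntegral.integral_neg, neg_neg] at h
    linarith
  simp [hodd]

/-- The integrand in the polar coordinates adapted to the frame `(u, perp u)`, after rescaling
by `ε`. -/
theorem rescaled_integrand_polar {ε r z : ℝ} (hε : 0 < ε) (hr : 0 < r) (θ : ℝ)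
    {u : EuclideanSpace ℝ (Fin 2)} (hu : ‖u‖ = 1) (ψ : EuclideanSpace ℝ (Fin 2))
    (F : EuclideanSpace ℝ (Fin 2) →ₗ[ℝ] EuclideanSpace ℝ (Fin 2))
    (η : EuclideanSpace ℝ (Fin 2))
    (hη : η = ε • r • (Real.cos θ • u + Real.sin θ • perp u)) :
    r • (alphaFn ε ((ε * z) • u) η / ‖η‖ ^ 3) • (⟪η, F η⟫ • ψ + ⟪ψ, η⟫ • F η) =
      (ε⁻¹ ^ 3 * Real.exp (-z ^ 2)) •
        (polarWeight z (r, θ) • (⟪perp u, F (perp u)⟫ • ψ + ⟪ψ, perp u⟫ • F (perp u)) +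
        (polarWeight z (r, θ) * Real.cos θ ^ 2) • ((⟪u, F u⟫ • ψ + ⟪ψ, u⟫ • F u) -
          (⟪perp u, F (perp u)⟫ • ψ + ⟪ψ, perp u⟫ • F (perp u))) +
        (polarWeight z (r, θ) * (Real.cos θ * Real.sin θ)) •
          ((⟪u, F (perp u)⟫ + ⟪perp u, F u⟫) • ψ + ⟪ψ, u⟫ • F (perp u) + ⟪ψ, perp u⟫ • F u)) := by
  have hup := inner_self_perp u
  have hp : ‖perp u‖ ^ 2 = 1 := by rw [norm_sq_perp, hu, one_pow]
  have hsc := Real.sin_sq_add_cos_sq θ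
  have hnorm_sq (a b : ℝ) : ‖a • u + b • perp u‖ ^ 2 = a ^ 2 + b ^ 2 := by
    rw [norm_add_sq_real, norm_smul, norm_smul, mul_pow, mul_pow, hp, hu, inner_smul_left,
      inner_smul_right, hup]
    simp
  have hη' : η = (ε * r * Real.cos θ) • u + (ε * r * Real.sin θ) • perp u := by
    rw [hη]; module
  have hnorm : ‖η‖ = ε * r := by
    rw [← sq_eq_sq₀ (norm_nonneg _) (by positivity), hη', hnorm_sq]
    linear_combination (ε * r) ^ 2 * hsc
  have hdist : ‖η - (ε * z) • u‖ ^ 2 = ε ^ 2 * (r ^ 2 - 2 * r * z * Real.cos θ + z ^ 2) := by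
    rw [show η - (ε * z) • u = (ε * r * Real.cos θ - ε * z) • u + (ε * r * Real.sin θ) • perp u by
      rw [hη']; module, hnorm_sq]
    linear_combination (ε * r) ^ 2 * hsc
  have hα : alphaFn ε ((ε * z) • u) η = ε⁻¹ ^ 2 * Real.exp (-z ^ 2) * polarWeight z (r, θ) := by
    rw [alphaFn, polarWeight, hdist, ← Real.exp_add, mul_assoc (ε⁻¹ ^ 2), ← Real.exp_add]
    congr 2
    field_simp
    ring
  rw [hα, hnorm, hη']
  simp only [map_add, map_smul, inner_add_left, inner_add_right, real_inner_smul_left,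
    real_inner_smul_right]
  have hs : Real.sin θ ^ 2 = 1 - Real.cos θ ^ 2 := by linarith
  match_scalars <;> field_simp <;> ring_nf <;> (try rw [hs]) <;> ring

theorem smul_frame_decomposition {u : EuclideanSpace ℝ (Fin 2)} (hu : ‖u‖ = 1)
    (ψ : EuclideanSpace ℝ (Fin 2)) : ψ = ⟪ψ, u⟫ • u + ⟪ψ, perp u⟫ • perp u := by
  have h := hu ▸ EuclideanSpace.norm_sq_eq u
  simp only [Fin.sum_univ_two, Real.norm_eq_abs, sq_abs] at h
  ext i
  fin_cases i <;> simp [PiLp.inner_apply, Fin.sum_univ_two, perp]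
  · linear_combination (ψ 0) * h
  · linear_combination (ψ 1) * h

/-- For `ε > 0`, `η₀` with `0 < |η₀| ≤ ε`, `ψ ∈ ℝ²` and a symmetric operator `F` on `ℝ²`
(a symmetric real 2×2 matrix), the absolutely convergent integral
`−(1/4π) ∫_{ℝ²} (α_{ε,η₀}(η)/|η|³)((ηᵀFη)ψ + ⟨ψ,η⟩Fη) dη` equals
`−(1/4π)(e^{−r̄₀²}/ε){[F²²M₅(r̄₀) + (F¹¹−F²²)M₁(r̄₀)]ψ
  + F((M₅(r̄₀)−M₁(r̄₀))ψ + (2M₁(r̄₀)−M₅(r̄₀))⟨ψ,u₀⟩u₀)}`. -/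
theorem stmt10 (ε : ℝ) (hε : 0 < ε) (η₀ ψ : EuclideanSpace ℝ (Fin 2))
    (h0 : 0 < ‖η₀‖) (h1 : ‖η₀‖ ≤ ε)
    (F : EuclideanSpace ℝ (Fin 2) →ₗ[ℝ] EuclideanSpace ℝ (Fin 2))
    (hF : ∀ x y : EuclideanSpace ℝ (Fin 2), ⟪F x, y⟫ = ⟪x, F y⟫)
    (r0 : ℝ) (hr0 : r0 = ‖η₀‖ / ε)
    (u0 : EuclideanSpace ℝ (Fin 2)) (hu0 : u0 = ‖η₀‖⁻¹ • η₀)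
    (F11 F22 : ℝ) (hF11 : F11 = ⟪u0, F u0⟫) (hF22 : F22 = ⟪perp u0, F (perp u0)⟫) :
    Integrable (fun η : EuclideanSpace ℝ (Fin 2) =>
      (alphaFn ε η₀ η / ‖η‖ ^ 3) • (⟪η, F η⟫ • ψ + ⟪ψ, η⟫ • F η)) ∧
    (-(1 / (4 * Real.pi)) •
        ∫ η : EuclideanSpace ℝ (Fin 2),
          (alphaFn ε η₀ η / ‖η‖ ^ 3) • (⟪η, F η⟫ • ψ + ⟪ψ, η⟫ • F η)) =
      (-(1 / (4 * Real.pi)) * (Real.exp (-r0 ^ 2) / ε)) •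
        ((F22 * M5R r0 + (F11 - F22) * M1R r0) • ψ +
          F ((M5R r0 - M1R r0) • ψ + ((2 * M1R r0 - M5R r0) * ⟪ψ, u0⟫) • u0)) := by

  have hu : ‖u0‖ = 1 := by
    rw [hu0, norm_smul, norm_inv, norm_norm, inv_mul_cancel₀ h0.ne']
  have hη₀ : η₀ = (ε * r0) • u0 := by
    rw [hu0, hr0, smul_smul, mul_div_cancel₀ _ hε.ne', mul_inv_cancel₀ h0.ne', one_smul]
  set f : EuclideanSpace ℝ (Fin 2) → EuclideanSpace ℝ (Fin 2) := fun η =>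
    (alphaFn ε η₀ η / ‖η‖ ^ 3) • (⟪η, F η⟫ • ψ + ⟪ψ, η⟫ • F η) with hf
  set A := ⟪perp u0, F (perp u0)⟫ • ψ + ⟪ψ, perp u0⟫ • F (perp u0) with hA
  set B := (⟪u0, F u0⟫ • ψ + ⟪ψ, u0⟫ • F u0) - A with hB
  set C := (⟪u0, F (perp u0)⟫ + ⟪perp u0, F u0⟫) • ψ + ⟪ψ, u0⟫ • F (perp u0) +
    ⟪ψ, perp u0⟫ • F u0
  have hpolar : Set.EqOn
      (fun p : ℝ × ℝ => p.1 • f (ε • p.1 • (Real.cos p.2 • u0 + Real.sin p.2 • perp u0)))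
      (fun p => (ε⁻¹ ^ 3 * Real.exp (-r0 ^ 2)) • (polarWeight r0 p • A +
        (polarWeight r0 p * Real.cos p.2 ^ 2) • B +
        (polarWeight r0 p * (Real.cos p.2 * Real.sin p.2)) • C)) polarCoord.target := by
    rintro ⟨r, θ⟩ hp
    simp only [hf, hη₀]
    exact rescaled_integrand_polar hε hp.1 θ hu ψ F _ rfl
  have hintA := (integrableOn_polarWeight r0).smul_const A
  have hintB := (integrableOn_polarWeight_mul_cos_sq r0).smul_const B
  have hintC := (integrableOn_polarWeight_mul_cos_mul_sin r0).smul_const C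
  have hmeas : MeasurableSet polarCoord.target := polarCoord.open_target.measurableSet
  refine ⟨?_, ?_⟩
  · rw [← integrable_comp_smul_iff volume f hε.ne',
      integrable_iff_integrableOn_polarCoord_frame hu, integrableOn_congr_fun hpolar hmeas]
    exact ((hintA.add hintB).add hintC).smul (ε⁻¹ ^ 3 * Real.exp (-r0 ^ 2))
  · have hscale : ∫ η, f η = ε ^ 2 • ∫ η, f (ε • η) := by
      rw [Measure.integral_comp_smul_of_nonneg volume f ε (hR := hε.le), finrank_euclideanSpace,
        Fintype.card_fin, smul_smul, mul_inv_cancel₀ (by positivity), one_smul]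
    have hadd := integral_add (hintA.add hintB) hintC
    simp only [Pi.add_apply] at hadd
    rw [hscale, integral_polarCoord_frame hu, setIntegral_congr_fun hmeas hpolar, integral_smul,
      hadd, integral_add hintA hintB, integral_smul_const,
      integral_smul_const, integral_smul_const, integral_polarWeight,
      integral_polarWeight_mul_cos_sq, integral_polarWeight_mul_cos_mul_sin, zero_smul, add_zero,
      smul_smul, smul_smul, hB, hA, hF11, hF22]
    have hFψ : F ψ = ⟪ψ, u0⟫ • F u0 + ⟪ψ, perp u0⟫ • F (perp u0) := by
      conv_lhs => rw [smul_frame_decomposition hu ψ, map_add, map_smul, map_smul]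
    rw [map_add, map_smul, map_smul, hFψ]
    match_scalars <;> field_simp <;> ring
end
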